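/- Let μ be a quasi-infinitely divisible distribution with characteristic pair (ζ, γ)_c. If μ is not a continuous measure (i.e., μ has an atom), then the Gaussian variance a = ζ({0}) equals 0; and if additionally ν⁻(ℝ) < ∞, then ν⁺(ℝ) < ∞. -/

import Mathlib

open MeasureTheory Complex Filter

noncomputable section

/-- Characteristic function of a measure on ℝ. -/
def charFn (μ : Measure ℝ) (z : ℝ) : ℂ := ∫ x, Complex.exp (Complex.I * z * x) ∂μ

/-- A representation function: bounded, Borel measurable, with (c x - x)/x² → 0 as x → 0. -/
def IsRepFn (c : ℝ → ℝ) : Prop :=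
  Measurable c ∧ (∃ M : ℝ, ∀ x, |c x| ≤ M) ∧
    Tendsto (fun x => (c x - x) / x ^ 2) (nhdsWithin 0 {(0:ℝ)}ᶜ) (nhds 0)

/-- The kernel g_c(x,z). -/
def gKer (c : ℝ → ℝ) (x z : ℝ) : ℂ :=
  if x = 0 then -(z:ℂ)^2 / 2
  else (Complex.exp (Complex.I * z * x) - 1 - Complex.I * z * c x) / ((min 1 (x^2) : ℝ) : ℂ)

/-- Quasi-infinitely divisible w.r.t. c: the characteristic function has a
Lévy–Khintchine type representation with a finite signed measure ζ = ζp - ζm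
(given by its Jordan decomposition). -/
def IsQID (c : ℝ → ℝ) (μ : Measure ℝ) : Prop :=
  ∃ γ : ℝ, ∃ ζp ζm : Measure ℝ, IsFiniteMeasure ζp ∧ IsFiniteMeasure ζm ∧
    Measure.MutuallySingular ζp ζm ∧
    ∀ z : ℝ, charFn μ z =
      Complex.exp (Complex.I * γ * z + (∫ x, gKer c x z ∂ζp) - ∫ x, gKer c x z ∂ζm)

/-- Infinitely divisible w.r.t. c: as above with a (positive) finite measure ζ. -/
def IsID (c : ℝ → ℝ) (μ : Measure ℝ) : Prop :=
  ∃ γ : ℝ, ∃ ζ : Measure ℝ, IsFiniteMeasure ζ ∧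
    ∀ z : ℝ, charFn μ z = Complex.exp (Complex.I * γ * z + ∫ x, gKer c x z ∂ζ)

/-- The Lévy–Khintchine integral ∫ (e^{izx} - 1 - izc(x)) dν. -/
def lkInt (c : ℝ → ℝ) (ν : Measure ℝ) (z : ℝ) : ℂ :=
  ∫ x, (Complex.exp (Complex.I * z * x) - 1 - Complex.I * z * c x) ∂ν

/-- μ has characteristic triplet (a, ν, γ) w.r.t. c, where the quasi-Lévy measure ν
is given by its Jordan decomposition ν = νp - νm. -/
def HasTriplet (c : ℝ → ℝ) (μ : Measure ℝ) (a : ℝ) (νp νm : Measure ℝ) (γ : ℝ) : Prop :=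
  Measure.MutuallySingular νp νm ∧ νp {0} = 0 ∧ νm {0} = 0 ∧
  (∫⁻ x, ENNReal.ofReal (min 1 (x^2)) ∂(νp + νm)) < ⊤ ∧
  ∀ z : ℝ, charFn μ z =
    Complex.exp (Complex.I * γ * z - a * z^2 / 2 + lkInt c νp z - lkInt c νm z)

/-- The averages of `μ` against `sinc` kernels concentrating at `x` converge to the mass of the atom at `x`. -/
lemma tendsto_integral_sinc (μ : Measure ℝ) [IsFiniteMeasure μ] (x : ℝ) :
    Tendsto (fun T : ℝ => ∫ y, Real.sinc (T * (-x + y)) ∂μ) atTop (nhds (μ.real {x})) := by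
  have key : Tendsto (fun T : ℝ => ∫ y, Real.sinc (T * (-x + y)) ∂μ) atTop
      (nhds (∫ y, ({x} : Set ℝ).indicator (fun _ => (1 : ℝ)) y ∂μ)) := by
    refine tendsto_integral_filter_of_dominated_convergence (fun _ => 1) ?_ ?_
      (integrable_const 1) ?_
    · exact .of_forall fun T =>
        (Real.continuous_sinc.comp (by fun_prop)).aestronglyMeasurable
    · exact .of_forall fun T => .of_forall fun y => Real.abs_sinc_le_one _
    · refine .of_forall fun y => ?_
      by_cases hy : y = x
      · simp [hy]
      · have hd : -x + y ≠ 0 := fun h => hy (by linarith)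
        simp only [Set.mem_singleton_iff, hy, not_false_eq_true, Set.indicator_of_notMem]
        have hlim : Tendsto (fun T : ℝ => |T * (-x + y)|⁻¹) atTop (nhds 0) := by
          refine tendsto_inv_atTop_zero.comp ?_
          simp only [abs_mul]
          exact tendsto_abs_atTop_atTop.atTop_mul_const (abs_pos.mpr hd)
        refine squeeze_zero_norm' ?_ hlim
        filter_upwards [eventually_gt_atTop 0] with T hT
        have hne : T * (-x + y) ≠ 0 := mul_ne_zero hT.ne' hd
        rw [Real.sinc_of_ne_zero hne, norm_div, Real.norm_eq_abs, Real.norm_eq_abs, div_eq_mul_inv]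
        exact mul_le_of_le_one_left (by positivity) (Real.abs_sin_le_one _)
  rwa [integral_indicator_const _ (measurableSet_singleton x), smul_eq_mul, mul_one] at key

/-- Averages of the modulus of the characteristic function bound the mass of every atom. -/
lemma measureReal_singleton_le_of_charFun (μ : Measure ℝ) [IsFiniteMeasure μ] (x δ : ℝ)
    (h : ∀ᶠ T : ℝ in atTop, ∫ u in (-1 : ℝ)..1, ‖charFun μ (T * u)‖ ≤ δ) :
    2 * μ.real {x} ≤ δ := by
  refine le_of_tendsto ((tendsto_integral_sinc μ x).const_mul 2) ?_
  filter_upwards [h] with T hT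
  refine le_trans ?_ hT
  have h1 := integral_charFun_Icc (μ := (μ.map (-x + ·)).map (T * ·)) (r := 1) one_pos
  have h2 : ∀ u : ℝ, ‖charFun ((μ.map (-x + ·)).map (T * ·)) u‖ = ‖charFun μ (T * u)‖ := by
    intro u
    rw [charFun_map_mul, charFun_map_const_add, norm_mul, Complex.norm_exp_ofReal_mul_I, mul_one]
  have h3 := intervalIntegral.norm_integral_le_integral_norm (μ := volume)
    (f := charFun ((μ.map (-x + ·)).map (T * ·))) (show (-1 : ℝ) ≤ 1 by norm_num)
  simp only [h2] at h3
  have hsinc : Measurable Real.sinc := Real.continuous_sinc.measurable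
  simp only [h1, one_mul, Complex.ofReal_one, mul_one, norm_mul, Complex.norm_real,
    Complex.norm_ofNat] at h3
  rw [integral_map (by fun_prop) (by fun_prop),
    integral_map (by fun_prop) (by fun_prop)] at h3
  exact (mul_le_mul_of_nonneg_left (le_abs_self _) zero_le_two).trans h3

lemma norm_exp_I_mul_sub_one_sub_le (t : ℝ) :
    ‖Complex.exp (Complex.I * t) - 1 - Complex.I * t‖ ≤ 3 * t ^ 2 := by
  by_cases ht : |t| ≤ 1
  · have h := Complex.norm_exp_sub_one_sub_id_le (x := Complex.I * t) (by simpa using ht)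
    have h' : ‖Complex.I * (t : ℂ)‖ ^ 2 = t ^ 2 := by simp
    nlinarith [sq_nonneg t]
  · have h1 : ‖Complex.exp (Complex.I * t) - 1 - Complex.I * t‖ ≤ 1 + 1 + |t| := by
      refine (norm_sub_le _ _).trans (add_le_add ((norm_sub_le _ _).trans ?_) ?_)
      · rw [Complex.norm_exp_I_mul_ofReal, norm_one]
      · simp
    nlinarith [sq_abs t]

lemma IsRepFn.norm_kernel_le {c : ℝ → ℝ} (hc : IsRepFn c) (z : ℝ) :
    ∃ K : ℝ, ∀ x : ℝ, x ≠ 0 →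
      ‖Complex.exp (Complex.I * z * x) - 1 - Complex.I * z * c x‖ ≤ K * min 1 (x ^ 2) := by
  obtain ⟨-, ⟨M, hM⟩, hlim⟩ := hc
  have h1 := (Metric.tendsto_nhdsWithin_nhds.mp hlim) 1 one_pos
  obtain ⟨ε, hε, h1⟩ := h1
  set δ := min ε 1 with hδ
  have hδ0 : 0 < δ := lt_min hε one_pos
  have hM0 : 0 ≤ M := (abs_nonneg _).trans (hM 0)
  refine ⟨3 * z ^ 2 + |z| + (2 + |z| * M) / δ ^ 2, fun x hx => ?_⟩
  have hx2 : 0 < x ^ 2 := by positivity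
  have hq : 0 ≤ (2 + |z| * M) / δ ^ 2 := by positivity
  by_cases hxδ : |x| < δ
  · have hx1 : |x| < 1 := hxδ.trans_le (min_le_right _ _)
    have hmin : min 1 (x ^ 2) = x ^ 2 := min_eq_right (by nlinarith [sq_abs x, abs_nonneg x])
    have h2 := h1 (x := x) (by simpa using hx) (by simpa using hxδ.trans_le (min_le_left _ _))
    rw [dist_zero_right, norm_div, Real.norm_eq_abs, Real.norm_eq_abs, abs_of_pos hx2,
      div_lt_one hx2] at h2
    have h3 := norm_exp_I_mul_sub_one_sub_le (z * x)
    have h4 : Complex.exp (Complex.I * z * x) - 1 - Complex.I * z * c x =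
        (Complex.exp (Complex.I * (z * x : ℝ)) - 1 - Complex.I * (z * x : ℝ)) -
          Complex.I * z * ((c x - x : ℝ) : ℂ) := by
      push_cast
      ring_nf
    rw [h4, hmin]
    refine (norm_sub_le _ _).trans ?_
    have h5 : ‖Complex.I * z * ((c x - x : ℝ) : ℂ)‖ = |z| * |c x - x| := by
      rw [norm_mul, norm_mul, Complex.norm_I, Complex.norm_real, Complex.norm_real]
      simp
    rw [h5]
    nlinarith [mul_le_mul_of_nonneg_left h2.le (abs_nonneg z), mul_nonneg hq hx2.le]
  · have hmin : δ ^ 2 ≤ min 1 (x ^ 2) := by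
      refine le_min (pow_le_one₀ hδ0.le (min_le_right _ _)) ?_
      rw [← sq_abs x]
      exact pow_le_pow_left₀ hδ0.le (not_lt.mp hxδ) 2
    have h2 : ‖Complex.exp (Complex.I * z * x) - 1 - Complex.I * z * c x‖ ≤ 2 + |z| * M := by
      refine (norm_sub_le _ _).trans (add_le_add ((norm_sub_le _ _).trans ?_) ?_)
      · rw [show Complex.I * (z : ℂ) * x = Complex.I * (z * x : ℝ) by push_cast; ring,
          Complex.norm_exp_I_mul_ofReal, norm_one]
        norm_num
      · rw [norm_mul, norm_mul, Complex.norm_I, Complex.norm_real, Complex.norm_real, one_mul]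
        exact mul_le_mul_of_nonneg_left (hM x) (abs_nonneg z)
    calc _ ≤ 2 + |z| * M := h2
      _ = (2 + |z| * M) / δ ^ 2 * δ ^ 2 := by field_simp
      _ ≤ (2 + |z| * M) / δ ^ 2 * min 1 (x ^ 2) := by gcongr
      _ ≤ _ := by gcongr; nlinarith [abs_nonneg z, sq_nonneg z]

lemma IsRepFn.integrable_kernel {c : ℝ → ℝ} (hc : IsRepFn c) {ν : Measure ℝ} (h0 : ν {0} = 0)
    (hν : Integrable (fun x : ℝ => min 1 (x ^ 2)) ν) (z : ℝ) :
    Integrable (fun x : ℝ => Complex.exp (Complex.I * z * x) - 1 - Complex.I * z * c x) ν := by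
  obtain ⟨K, hK⟩ := hc.norm_kernel_le z
  have hcm := hc.1
  refine (hν.const_mul K).mono' (by fun_prop) ?_
  filter_upwards [compl_mem_ae_iff.mpr h0] with x hx using hK x hx

/-- The real part of the negated Lévy–Khintchine exponent. -/
def reExponent (ν : Measure ℝ) (z : ℝ) : ℝ := ∫ x, (1 - Real.cos (z * x)) ∂ν

lemma re_kernel (c : ℝ → ℝ) (z x : ℝ) :
    1 - Real.cos (z * x) =
      -(Complex.exp (Complex.I * z * x) - 1 - Complex.I * z * c x).re := by
  rw [show Complex.I * (z : ℂ) * x = (z * x : ℝ) * Complex.I by push_cast; ring]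
  have h : (Complex.I * (z : ℂ) * (c x : ℂ)).re = 0 := by simp
  rw [Complex.sub_re, Complex.sub_re, Complex.exp_ofReal_mul_I_re, h, Complex.one_re]
  ring

lemma IsRepFn.integrable_one_sub_cos {c : ℝ → ℝ} (hc : IsRepFn c) {ν : Measure ℝ}
    (h0 : ν {0} = 0) (hν : Integrable (fun x : ℝ => min 1 (x ^ 2)) ν) (z : ℝ) :
    Integrable (fun x : ℝ => 1 - Real.cos (z * x)) ν := by
  simp only [re_kernel c]
  exact (hc.integrable_kernel h0 hν z).re.neg

lemma IsRepFn.re_lkInt {c : ℝ → ℝ} (hc : IsRepFn c) {ν : Measure ℝ} (h0 : ν {0} = 0)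
    (hν : Integrable (fun x : ℝ => min 1 (x ^ 2)) ν) (z : ℝ) :
    (lkInt c ν z).re = -reExponent ν z := by
  have h := Complex.reCLM.integral_comp_comm (hc.integrable_kernel h0 hν z)
  simp only [Complex.reCLM_apply] at h
  simp only [reExponent, re_kernel c, integral_neg, neg_neg, lkInt, h]

lemma reExponent_le (ν : Measure ℝ) [IsFiniteMeasure ν] (z : ℝ) :
    reExponent ν z ≤ 2 * ν.real Set.univ := by
  have h : reExponent ν z ≤ ∫ _, (2 : ℝ) ∂ν := by
    refine integral_mono_of_nonneg (.of_forall fun _ => sub_nonneg.mpr (Real.cos_le_one _))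
      (integrable_const _) (.of_forall fun x => ?_)
    linarith [Real.neg_one_le_cos (z * x)]
  rw [integral_const, smul_eq_mul] at h
  linarith

lemma tendsto_reExponent_div_sq {ν : Measure ℝ}
    (hν : Integrable (fun x : ℝ => min 1 (x ^ 2)) ν) :
    Tendsto (fun z : ℝ => reExponent ν z / z ^ 2) atTop (nhds 0) := by
  have key : Tendsto (fun z : ℝ => ∫ x, (1 - Real.cos (z * x)) / z ^ 2 ∂ν) atTop
      (nhds (∫ _, (0 : ℝ) ∂ν)) := by
    refine tendsto_integral_filter_of_dominated_convergence (fun x => 2 * min 1 (x ^ 2))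
      (.of_forall fun z => by fun_prop) ?_ (hν.const_mul 2) (.of_forall fun x => ?_)
    · filter_upwards [eventually_ge_atTop 1] with z hz
      refine .of_forall fun x => ?_
      have hz2 : (1 : ℝ) ≤ z ^ 2 := one_le_pow₀ hz
      have h0 := sub_nonneg.mpr (Real.cos_le_one (z * x))
      rw [Real.norm_of_nonneg (by positivity), div_le_iff₀ (by positivity)]
      rcases le_total 1 (x ^ 2) with h | h
      · rw [min_eq_left h]
        nlinarith [Real.neg_one_le_cos (z * x)]
      · rw [min_eq_right h]
        nlinarith [Real.one_sub_sq_div_two_le_cos (x := z * x), sq_nonneg (z * x)]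
    · have hlim : Tendsto (fun z : ℝ => 2 / z ^ 2) atTop (nhds 0) :=
        Tendsto.const_div_atTop (tendsto_pow_atTop two_ne_zero) 2
      refine squeeze_zero (fun z => ?_) (fun z => ?_) hlim
      · have h0 := sub_nonneg.mpr (Real.cos_le_one (z * x))
        positivity
      · gcongr
        linarith [Real.neg_one_le_cos (z * x)]
  simpa [reExponent, integral_div] using key

lemma integral_comp_mul_le_of_periodic {h : ℝ → ℝ} (hcont : Continuous h) (h0 : ∀ x, 0 ≤ h x)
    (hper : Function.Periodic h (2 * Real.pi)) {s : ℝ} (hs : Real.pi ≤ s) :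
    ∫ u in (-1 : ℝ)..1, h (s * u) ≤ 2 / Real.pi * ∫ v in (0 : ℝ)..2 * Real.pi, h v := by
  have hpi := Real.pi_pos
  have hs0 : 0 < s := hpi.trans_le hs
  set P := ∫ v in (0 : ℝ)..2 * Real.pi, h v with hP
  have hP0 : 0 ≤ P := intervalIntegral.integral_nonneg (by positivity) fun x _ => h0 x
  set n : ℤ := ⌈s / Real.pi⌉ with hn
  have hn1 : s / Real.pi ≤ n := Int.le_ceil _
  have hn2 : (n : ℝ) ≤ 2 * s / Real.pi := by
    have h1 : (n : ℝ) < s / Real.pi + 1 := Int.ceil_lt_add_one _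
    have h2 : 1 ≤ s / Real.pi := (one_le_div hpi).mpr hs
    have h3 : 2 * s / Real.pi = s / Real.pi + s / Real.pi := by ring
    linarith
  have hint : ∀ a b : ℝ, IntervalIntegrable h volume a b := fun a b => hcont.intervalIntegrable a b
  have e1 : ∫ u in (-1 : ℝ)..1, h (s * u) = s⁻¹ * ∫ v in -s..s, h v := by
    rw [intervalIntegral.integral_comp_mul_left h hs0.ne']
    simp
  have e2 : ∫ v in -s..s, h v ≤ ∫ v in -s..-s + n • (2 * Real.pi), h v := by
    refine intervalIntegral.integral_mono_interval le_rfl (by linarith) ?_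
      (.of_forall fun x => h0 x) (hint _ _)
    rw [zsmul_eq_mul]
    have := (div_le_iff₀ hpi).mp hn1
    linarith
  have e3 : ∫ v in -s..-s + n • (2 * Real.pi), h v = n * P := by
    rw [hper.intervalIntegral_add_zsmul_eq n (-s) hint, hper.intervalIntegral_add_eq (-s) 0,
      zero_add, zsmul_eq_mul]
  calc _ = s⁻¹ * ∫ v in -s..s, h v := e1
    _ ≤ s⁻¹ * (2 * s / Real.pi * P) := by
      gcongr
      exact (e2.trans_eq e3).trans (by gcongr)
    _ = _ := by field_simp

lemma tendsto_integral_exp_neg_mul_one_sub_cos :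
    Tendsto (fun m : ℝ => ∫ v in (0 : ℝ)..2 * Real.pi, Real.exp (-(m * (1 - Real.cos v))))
      atTop (nhds 0) := by
  have key : Tendsto
      (fun m : ℝ => ∫ v in (0 : ℝ)..2 * Real.pi, Real.exp (-(m * (1 - Real.cos v))))
      atTop (nhds (∫ _ in (0 : ℝ)..2 * Real.pi, (0 : ℝ))) := by
    refine intervalIntegral.tendsto_integral_filter_of_dominated_convergence (fun _ => 1)
      (.of_forall fun m => by fun_prop) ?_ intervalIntegrable_const ?_
    · filter_upwards [eventually_ge_atTop 0] with m hm
      refine .of_forall fun v _ => ?_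
      rw [Real.norm_of_nonneg (Real.exp_nonneg _), Real.exp_le_one_iff, neg_nonpos]
      exact mul_nonneg hm (sub_nonneg.mpr (Real.cos_le_one v))
    · filter_upwards [compl_mem_ae_iff.mpr (measure_singleton (2 * Real.pi))] with v hv hmem
      rw [Set.uIoc_of_le (by positivity)] at hmem
      have hlt : v < 2 * Real.pi := lt_of_le_of_ne hmem.2 hv
      have hne : Real.cos v ≠ 1 := by
        rw [Ne, Real.cos_eq_one_iff_of_lt_of_lt (by linarith [hmem.1, Real.pi_pos]) hlt]
        exact hmem.1.ne'
      have hpos : 0 < 1 - Real.cos v := sub_pos.mpr (lt_of_le_of_ne (Real.cos_le_one v) hne)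
      exact Real.tendsto_exp_neg_atTop_nhds_zero.comp (tendsto_id.atTop_mul_const hpos)
  simpa using key

/-- Jensen's inequality for the exponential and a finite measure. -/
lemma exp_neg_reExponent_le (ν : Measure ℝ) [IsFiniteMeasure ν] [NeZero ν] (z : ℝ) :
    Real.exp (-reExponent ν z) ≤ (ν.real Set.univ)⁻¹ *
      ∫ x, Real.exp (-(ν.real Set.univ * (1 - Real.cos (z * x)))) ∂ν := by
  have hm : ν.real Set.univ ≠ 0 := (measureReal_ne_zero_iff).mpr (NeZero.ne _)
  have hb : ∀ x : ℝ, 0 ≤ ν.real Set.univ * (1 - Real.cos (z * x)) := fun x =>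
    mul_nonneg measureReal_nonneg (sub_nonneg.mpr (Real.cos_le_one _))
  have h := convexOn_exp.map_average_le (μ := ν)
    (f := fun x => -(ν.real Set.univ * (1 - Real.cos (z * x))))
    Real.continuous_exp.continuousOn isClosed_univ (by simp) ?_ ?_
  · rw [average_eq, average_eq, integral_neg, integral_const_mul, smul_eq_mul, smul_eq_mul,
      mul_neg, inv_mul_cancel_left₀ hm] at h
    exact h
  · refine .of_bound (by fun_prop) (ν.real Set.univ * 2) (.of_forall fun x => ?_)
    rw [norm_neg, Real.norm_of_nonneg (hb x)]
    gcongr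
    linarith [Real.neg_one_le_cos (z * x)]
  · refine .of_bound (by fun_prop) 1 (.of_forall fun x => ?_)
    rw [Function.comp_apply, Real.norm_of_nonneg (Real.exp_nonneg _), Real.exp_le_one_iff,
      neg_nonpos]
    exact hb x

/-- A concentration bound, in the spirit of Kolmogorov–Rogozin, for the compound Poisson law with
Lévy measure `ν` supported away from zero. -/
lemma integral_le_of_le_exp_neg_reExponent (ν : Measure ℝ) [IsFiniteMeasure ν] [NeZero ν]
    {r T : ℝ} (hr : ∀ᵐ x ∂ν, r ≤ |x|) (hT : 0 ≤ T) (hTr : Real.pi ≤ T * r)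
    {f : ℝ → ℝ} (hf : Continuous f) {C : ℝ} (hC : 0 ≤ C)
    (hle : ∀ u, f u ≤ C * Real.exp (-reExponent ν (T * u))) :
    ∫ u in (-1 : ℝ)..1, f u ≤ C * (2 / Real.pi *
      ∫ v in (0 : ℝ)..2 * Real.pi, Real.exp (-(ν.real Set.univ * (1 - Real.cos v)))) := by
  set m := ν.real Set.univ with hm
  have hm0 : 0 ≤ m := measureReal_nonneg
  have hmne : m ≠ 0 := (measureReal_ne_zero_iff).mpr (NeZero.ne _)
  set P := ∫ v in (0 : ℝ)..2 * Real.pi, Real.exp (-(m * (1 - Real.cos v)))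
  have hbd : ∀ v : ℝ, ‖Real.exp (-(m * (1 - Real.cos v)))‖ ≤ 1 := fun v => by
    rw [Real.norm_of_nonneg (Real.exp_nonneg _), Real.exp_le_one_iff, neg_nonpos]
    exact mul_nonneg hm0 (sub_nonneg.mpr (Real.cos_le_one _))
  have hprod : Integrable
      (Function.uncurry fun u x : ℝ => Real.exp (-(m * (1 - Real.cos (T * u * x)))))
      ((volume.restrict (Set.uIoc (-1 : ℝ) 1)).prod ν) := by
    have : IsFiniteMeasure (volume.restrict (Set.uIoc (-1 : ℝ) 1)) :=
      ⟨by simp [Set.uIoc]⟩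
    exact .of_bound (Continuous.aestronglyMeasurable (by fun_prop)) 1
      (.of_forall fun p => hbd _)
  have hinner : ∀ᵐ x ∂ν,
      ∫ u in (-1 : ℝ)..1, Real.exp (-(m * (1 - Real.cos (T * u * x)))) ≤ 2 / Real.pi * P := by
    filter_upwards [hr] with x hx
    have hcos : ∀ u : ℝ, Real.cos (T * u * x) = Real.cos (T * |x| * u) := fun u => by
      rw [← Real.cos_abs (T * u * x), ← Real.cos_abs (T * |x| * u)]
      simp only [abs_mul, abs_abs]
      ring_nf
    simp only [hcos]
    exact integral_comp_mul_le_of_periodic (h := fun v => Real.exp (-(m * (1 - Real.cos v))))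
      (by fun_prop) (fun v => Real.exp_nonneg _) (fun v => by simp)
      (hTr.trans (by gcongr))
  have hint : IntervalIntegrable
      (fun u => ∫ x, Real.exp (-(m * (1 - Real.cos (T * u * x)))) ∂ν) volume (-1) 1 := by
    rw [intervalIntegrable_iff]
    exact hprod.integral_prod_left
  calc ∫ u in (-1 : ℝ)..1, f u
      ≤ ∫ u in (-1 : ℝ)..1,
          C * (m⁻¹ * ∫ x, Real.exp (-(m * (1 - Real.cos (T * u * x)))) ∂ν) := by
        refine intervalIntegral.integral_mono_on (by norm_num) (hf.intervalIntegrable _ _)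
          ((hint.const_mul _).const_mul _) fun u _ => (hle u).trans ?_
        gcongr
        exact exp_neg_reExponent_le ν (T * u)
    _ = C * (m⁻¹ * ∫ x, (∫ u in (-1 : ℝ)..1,
          Real.exp (-(m * (1 - Real.cos (T * u * x))))) ∂ν) := by
        rw [intervalIntegral.integral_const_mul, intervalIntegral.integral_const_mul,
          intervalIntegral_integral_swap hprod]
    _ ≤ C * (m⁻¹ * ∫ _, 2 / Real.pi * P ∂ν) := by
        refine mul_le_mul_of_nonneg_left (mul_le_mul_of_nonneg_left ?_ (inv_nonneg.mpr hm0)) hC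
        refine integral_mono_of_nonneg (.of_forall fun x => ?_) (integrable_const _) hinner
        exact intervalIntegral.integral_nonneg (by norm_num) fun u _ => Real.exp_nonneg _
    _ = _ := by
        rw [integral_const, smul_eq_mul, inv_mul_cancel_left₀ hmne]

lemma charFn_eq_charFun (μ : Measure ℝ) (z : ℝ) : charFn μ z = charFun μ z := by
  rw [charFn, charFun_apply_real]
  congr with x
  ring_nf

lemma integrable_min_one_sq {ν ν' : Measure ℝ} (hle : ν ≤ ν')
    (h : (∫⁻ x, ENNReal.ofReal (min 1 (x ^ 2)) ∂ν') < ⊤) :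
    Integrable (fun x : ℝ => min 1 (x ^ 2)) ν := by
  refine ⟨by fun_prop, ?_⟩
  rw [hasFiniteIntegral_iff_ofReal (.of_forall fun x => by positivity)]
  exact (lintegral_mono' hle le_rfl).trans_lt h

lemma HasTriplet.norm_charFun {c : ℝ → ℝ} (hc : IsRepFn c) {μ : Measure ℝ} {a γ : ℝ}
    {νp νm : Measure ℝ} (h : HasTriplet c μ a νp νm γ) (z : ℝ) :
    ‖charFun μ z‖ = Real.exp (-(a / 2 * z ^ 2) - reExponent νp z + reExponent νm z) := by
  obtain ⟨-, hp0, hm0, hfin, hch⟩ := h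
  have hp := integrable_min_one_sq (Measure.le_add_right le_rfl) hfin
  have hm := integrable_min_one_sq (Measure.le_add_left le_rfl) hfin
  have hre : (Complex.I * γ * z - a * z ^ 2 / 2 : ℂ).re = -(a / 2 * z ^ 2) := by
    rw [show (Complex.I * γ * z - a * z ^ 2 / 2 : ℂ) =
      (-(a / 2 * z ^ 2) : ℝ) + (γ * z : ℝ) * Complex.I by push_cast; ring]
    simp [-Complex.ofReal_mul, -Complex.ofReal_neg]
  rw [← charFn_eq_charFun, hch, Complex.norm_exp, Complex.sub_re, Complex.add_re, hre,
    hc.re_lkInt hp0 hp, hc.re_lkInt hm0 hm]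
  ring_nf

lemma HasTriplet.tendsto_exponent_div_sq {c : ℝ → ℝ} {μ : Measure ℝ} {a γ : ℝ}
    {νp νm : Measure ℝ} (h : HasTriplet c μ a νp νm γ) :
    Tendsto (fun z : ℝ => -(a / 2) - reExponent νp z / z ^ 2 + reExponent νm z / z ^ 2) atTop
      (nhds (-(a / 2))) := by
  have hp := tendsto_reExponent_div_sq
    (integrable_min_one_sq (Measure.le_add_right le_rfl) h.2.2.2.1 :
      Integrable (fun x : ℝ => min 1 (x ^ 2)) νp)
  have hm := tendsto_reExponent_div_sq
    (integrable_min_one_sq (Measure.le_add_left le_rfl) h.2.2.2.1 :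
      Integrable (fun x : ℝ => min 1 (x ^ 2)) νm)
  simpa using (tendsto_const_nhds.sub hp).add hm

lemma HasTriplet.gaussian_nonneg {c : ℝ → ℝ} (hc : IsRepFn c) {μ : Measure ℝ}
    [IsProbabilityMeasure μ] {a γ : ℝ} {νp νm : Measure ℝ} (h : HasTriplet c μ a νp νm γ) :
    0 ≤ a := by
  by_contra! ha
  have hlim := (tendsto_pow_atTop two_ne_zero).atTop_mul_pos
    (show (0 : ℝ) < -(a / 2) by linarith) h.tendsto_exponent_div_sq
  obtain ⟨z, hz1, hz0⟩ := ((hlim.eventually_gt_atTop 0).and (eventually_gt_atTop 0)).exists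
  have h1 := norm_charFun_le_one (μ := μ) z
  rw [h.norm_charFun hc, Real.exp_le_one_iff] at h1
  have h2 : z ^ 2 * (-(a / 2) - reExponent νp z / z ^ 2 + reExponent νm z / z ^ 2) =
      -(a / 2 * z ^ 2) - reExponent νp z + reExponent νm z := by field_simp
  linarith

lemma HasTriplet.tendsto_norm_charFun {c : ℝ → ℝ} (hc : IsRepFn c) {μ : Measure ℝ}
    {a γ : ℝ} {νp νm : Measure ℝ} (h : HasTriplet c μ a νp νm γ) (ha : 0 < a) :
    Tendsto (fun z : ℝ => ‖charFun μ z‖) atTop (nhds 0) := by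
  have hlim := (tendsto_pow_atTop two_ne_zero).atTop_mul_neg
    (show -(a / 2) < (0 : ℝ) by linarith) h.tendsto_exponent_div_sq
  refine (Real.tendsto_exp_atBot.comp hlim).congr' ?_
  filter_upwards [eventually_gt_atTop 0] with z hz
  rw [Function.comp_apply, h.norm_charFun hc]
  congr 1
  field_simp

lemma norm_charFun_abs (μ : Measure ℝ) (z : ℝ) : ‖charFun μ |z|‖ = ‖charFun μ z‖ := by
  rcases abs_choice z with hz | hz <;> rw [hz]
  rw [charFun_neg, RCLike.norm_conj]

/-- A probability measure whose characteristic function vanishes at infinity has no atoms. -/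
lemma measure_singleton_eq_zero_of_tendsto_charFun (μ : Measure ℝ) [IsProbabilityMeasure μ]
    (h : Tendsto (fun z : ℝ => ‖charFun μ z‖) atTop (nhds 0)) (x : ℝ) : μ {x} = 0 := by
  have key : Tendsto (fun T : ℝ => ∫ u in (-1 : ℝ)..1, ‖charFun μ (T * u)‖) atTop
      (nhds (∫ _ in (-1 : ℝ)..1, (0 : ℝ))) := by
    have hcont : Continuous (charFun μ) := continuous_charFun
    refine intervalIntegral.tendsto_integral_filter_of_dominated_convergence (fun _ => 1)
      (.of_forall fun T => Continuous.aestronglyMeasurable (by fun_prop))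
      (.of_forall fun T => .of_forall fun u _ => by simpa using norm_charFun_le_one (T * u))
      intervalIntegrable_const ?_
    filter_upwards [compl_mem_ae_iff.mpr (measure_singleton (0 : ℝ))] with u hu _
    have hT : Tendsto (fun T : ℝ => |T * u|) atTop atTop := by
      simp only [abs_mul]
      exact tendsto_abs_atTop_atTop.atTop_mul_const (abs_pos.mpr hu)
    simpa only [Function.comp_def, norm_charFun_abs] using h.comp hT
  rw [intervalIntegral.integral_zero] at key
  rw [← measureReal_eq_zero_iff]
  refine le_antisymm (le_of_forall_pos_le_add fun ε hε => ?_) measureReal_nonneg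
  have := measureReal_singleton_le_of_charFun μ x ε (key.eventually_le_const hε)
  linarith [measureReal_nonneg (μ := μ) (s := {x})]

lemma measure_lt_abs_lt_top {ν : Measure ℝ} (hν : Integrable (fun x : ℝ => min 1 (x ^ 2)) ν)
    {r : ℝ} (hr : 0 < r) : ν {x | r < |x|} < ⊤ := by
  refine (measure_mono fun x hx => ?_).trans_lt
    (hν.measure_ge_lt_top (ε := min 1 (r ^ 2)) (by positivity))
  have hx' : r < |x| := hx
  change min 1 (r ^ 2) ≤ min 1 (x ^ 2)
  rw [← sq_abs x]
  gcongr

lemma tendsto_measure_lt_abs {ν : Measure ℝ} (h0 : ν {0} = 0) :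
    Tendsto (fun n : ℕ => ν {x | 1 / ((n : ℝ) + 1) < |x|}) atTop (nhds (ν Set.univ)) := by
  have hU : ⋃ n : ℕ, {x : ℝ | 1 / ((n : ℝ) + 1) < |x|} = {0}ᶜ := by
    ext x
    simp only [Set.mem_iUnion, Set.mem_ofPred_eq, Set.mem_compl_iff, Set.mem_singleton_iff]
    constructor
    · rintro ⟨n, hn⟩ rfl
      rw [abs_zero] at hn
      exact absurd hn (not_lt.mpr (by positivity))
    · exact fun hx => exists_nat_one_div_lt (abs_pos.mpr hx)
  have huniv : ν Set.univ = ν {0}ᶜ := (measure_congr (ae_eq_univ.mpr (by simpa using h0))).symm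
  rw [huniv, ← hU]
  refine tendsto_measure_iUnion_atTop fun i j hij x hx => ?_
  have hx' : 1 / ((i : ℝ) + 1) < |x| := hx
  exact lt_of_le_of_lt (Nat.one_div_le_one_div hij) hx'

lemma HasTriplet.measure_singleton_eq_zero {c : ℝ → ℝ} (hc : IsRepFn c) {μ : Measure ℝ}
    [IsProbabilityMeasure μ] {a γ : ℝ} {νp νm : Measure ℝ} (h : HasTriplet c μ a νp νm γ)
    (hm : νm Set.univ < ⊤) (hp : νp Set.univ = ⊤) (x : ℝ) : μ {x} = 0 := by
  have : IsFiniteMeasure νm := ⟨hm⟩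
  have hp0 := h.2.1
  have hint : Integrable (fun x : ℝ => min 1 (x ^ 2)) νp :=
    integrable_min_one_sq (Measure.le_add_right le_rfl) h.2.2.2.1
  have ha := h.gaussian_nonneg hc
  set C := Real.exp (2 * νm.real Set.univ)
  rw [← measureReal_eq_zero_iff]
  refine le_antisymm (le_of_forall_pos_le_add fun ε hε => ?_) measureReal_nonneg
  have hsmall := (tendsto_integral_exp_neg_mul_one_sub_cos.const_mul (2 / Real.pi)).const_mul C
  rw [mul_zero, mul_zero] at hsmall
  obtain ⟨M, hM⟩ := eventually_atTop.mp (hsmall.eventually_le_const hε)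
  have hn := tendsto_measure_lt_abs hp0
  rw [hp] at hn
  obtain ⟨n, hn⟩ := (hn.eventually
    (lt_mem_nhds (ENNReal.ofReal_lt_top (r := max M 1)))).exists
  set r : ℝ := 1 / ((n : ℝ) + 1)
  have hr : 0 < r := by positivity
  set S : Set ℝ := {x | r < |x|}
  have hS : MeasurableSet S := measurableSet_lt measurable_const (by fun_prop)
  set ν := νp.restrict S
  have hfin : νp S < ⊤ := measure_lt_abs_lt_top hint hr
  have hνuniv : ν Set.univ = νp S := Measure.restrict_apply_univ S
  have : IsFiniteMeasure ν := ⟨hνuniv ▸ hfin⟩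
  have hmass : max M 1 < ν.real Set.univ := by
    rw [measureReal_def, hνuniv]
    exact (ENNReal.ofReal_lt_iff_lt_toReal (by positivity) hfin.ne).mp hn
  have : NeZero ν := ⟨fun h0 => by
    rw [h0] at hmass
    simp at hmass
    linarith [hmass.2]⟩
  have hle : ∀ z, ‖charFun μ z‖ ≤ C * Real.exp (-reExponent ν z) := by
    intro z
    rw [h.norm_charFun hc, ← Real.exp_add, Real.exp_le_exp]
    have h1 : reExponent ν z ≤ reExponent νp z :=
      setIntegral_le_integral (hc.integrable_one_sub_cos hp0 hint z)
        (.of_forall fun x => sub_nonneg.mpr (Real.cos_le_one _))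
    have h2 := reExponent_le νm z
    nlinarith [mul_nonneg ha (sq_nonneg z)]
  have hcont : Continuous (charFun μ) := continuous_charFun
  have := measureReal_singleton_le_of_charFun μ x ε ?_
  · linarith [measureReal_nonneg (μ := μ) (s := {x})]
  filter_upwards [eventually_ge_atTop (Real.pi / r)] with T hT
  have hT0 : 0 ≤ T := le_trans (by positivity) hT
  refine (integral_le_of_le_exp_neg_reExponent ν (r := r) ?_ hT0 ((div_le_iff₀ hr).mp hT)
    (by fun_prop) (Real.exp_nonneg _) fun u => hle (T * u)).trans
      (hM _ ((le_max_left _ _).trans hmass.le))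
  filter_upwards [ae_restrict_mem hS] with y hy using le_of_lt hy

/-- if μ is quasi-infinitely divisible and has an atom, then its
Gaussian variance is 0, and if moreover ν⁻(ℝ) < ∞ then ν⁺(ℝ) < ∞. -/
theorem stmt16 (c : ℝ → ℝ) (hc : IsRepFn c) (μ : Measure ℝ) [IsProbabilityMeasure μ]
    (a γ : ℝ) (νp νm : Measure ℝ) (h : HasTriplet c μ a νp νm γ)
    (hatom : ∃ x : ℝ, μ {x} ≠ 0) :
    a = 0 ∧ (νm Set.univ < ⊤ → νp Set.univ < ⊤) := by
  obtain ⟨x, hx⟩ := hatom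
  refine ⟨le_antisymm (not_lt.mp fun ha => hx ?_) (h.gaussian_nonneg hc), fun hm => ?_⟩
  · exact measure_singleton_eq_zero_of_tendsto_charFun μ (h.tendsto_norm_charFun hc ha) x
  · exact lt_top_iff_ne_top.mpr fun hp => hx (h.measure_singleton_eq_zero hc hm hp x)
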